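/- Let K ⊂ ℝⁿ be an isotropic convex body with isotropy parameter M_K, and let (C_m)_{m≥1} be Borel subsets of ℝⁿ with C_m ∩ int(K) = ∅, |C_m| > 0, |C_m| → 0, such that K_m := K ∪ C_m is a convex body for every m. Then there exist a constant C > 0 and m₀ such that for all m ≥ m₀: | (1/n!) ∫_{K_m} ⋯ ∫_{K_m} (det(X₁,…,Xₙ))² dX₁ ⋯ dXₙ − M_K^{2n} − M_K^{2(n−1)} ∫_{C_m} |X|² dX | ≤ C |K_m \ K|². -/

import Mathlib

open MeasureTheory Metric Set Filter
open scoped InnerProductSpace Topology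

noncomputable section

/-- A convex body in ℝⁿ: a compact convex set with nonempty interior. -/
def IsConvexBody {n : ℕ} (K : Set (EuclideanSpace ℝ (Fin n))) : Prop :=
  IsCompact K ∧ Convex ℝ K ∧ (interior K).Nonempty

/-- The centroid of a set. -/
def centroid {n : ℕ} (K : Set (EuclideanSpace ℝ (Fin n))) : EuclideanSpace ℝ (Fin n) :=
  ((volume K).toReal)⁻¹ • ∫ x in K, x

/-- `(1/n!) ∫_{A}⋯∫_{A} det(X₁ − g, …, Xₙ − g)² dX₁ ⋯ dXₙ`. -/
def detInt {n : ℕ} (A : Set (EuclideanSpace ℝ (Fin n))) (g : EuclideanSpace ℝ (Fin n)) : ℝ :=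
  ((n.factorial : ℝ))⁻¹ *
    ∫ X in Set.univ.pi (fun _ : Fin n => A),
      (Matrix.det (Matrix.of fun i j : Fin n => X j i - g i)) ^ 2
      ∂(Measure.pi fun _ : Fin n => volume)

/-- `M_K^{2n}`, the 2n-th power of the isotropy parameter of a convex body. -/
def Mpow2n {n : ℕ} (K : Set (EuclideanSpace ℝ (Fin n))) : ℝ := detInt K (centroid K)

/-- The isotropy constant `L_K = M_K / |K|^{(n+2)/(2n)}` of a convex body. -/
def isoL (n : ℕ) (K : Set (EuclideanSpace ℝ (Fin n))) : ℝ :=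
  (Mpow2n K) ^ ((2 * (n : ℝ)))⁻¹ / (volume K).toReal ^ (((n : ℝ) + 2) / (2 * n))

/-- `K` is isotropic with isotropy parameter `M`. -/
def IsIsotropic {n : ℕ} (K : Set (EuclideanSpace ℝ (Fin n))) (M : ℝ) : Prop :=
  0 < M ∧ (∫ x in K, x) = 0 ∧
    ∀ y : EuclideanSpace ℝ (Fin n), (∫ x in K, (⟪x, y⟫_ℝ) ^ 2) = M ^ 2 * ‖y‖ ^ 2

/-- `(N, q)` witnesses positive generalized Gauss curvature of `K` at `X₀`. -/
def CurvWitness {n : ℕ} (K : Set (EuclideanSpace ℝ (Fin n))) (X₀ N : EuclideanSpace ℝ (Fin n))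
    (q : QuadraticForm ℝ (EuclideanSpace ℝ (Fin n))) : Prop :=
  ‖N‖ = 1 ∧ (∀ x ∈ K, 0 ≤ ⟪x - X₀, N⟫_ℝ) ∧
  (∀ Y : EuclideanSpace ℝ (Fin n), ⟪Y, N⟫_ℝ = 0 → Y ≠ 0 → 0 < q Y) ∧
  ∀ ε > (0 : ℝ), ∃ a > (0 : ℝ), ∀ (Y : EuclideanSpace ℝ (Fin n)) (y : ℝ), ⟪Y, N⟫_ℝ = 0 →
    X₀ + Y + y • N ∈ frontier K ∩ Metric.ball X₀ a →
    (1 - ε) * q Y ≤ y ∧ y ≤ (1 + ε) * q Y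

/-- `K` has positive generalized Gauss curvature at `X₀`. -/
def HasPosGenCurvature {n : ℕ} (K : Set (EuclideanSpace ℝ (Fin n)))
    (X₀ : EuclideanSpace ℝ (Fin n)) : Prop :=
  ∃ N q, CurvWitness K X₀ N q

/-- `K` is a local maximizer for the isotropy constant (Hausdorff distance). -/
def IsLocalMaxIso {n : ℕ} (K : Set (EuclideanSpace ℝ (Fin n))) : Prop :=
  ∃ ε > (0 : ℝ), ∀ K' : Set (EuclideanSpace ℝ (Fin n)), IsConvexBody K' →
    hausdorffDist K' K < ε → isoL n K' ≤ isoL n K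

/-- `K` is a local minimizer for the isotropy constant (Hausdorff distance). -/
def IsLocalMinIso {n : ℕ} (K : Set (EuclideanSpace ℝ (Fin n))) : Prop :=
  ∃ ε > (0 : ℝ), ∀ K' : Set (EuclideanSpace ℝ (Fin n)), IsConvexBody K' →
    hausdorffDist K' K < ε → isoL n K ≤ isoL n K'

/-- `X₀` is a point of local strict convexity of `∂K`. -/
def IsLocalStrictConvexPoint {n : ℕ} (K : Set (EuclideanSpace ℝ (Fin n)))
    (X₀ : EuclideanSpace ℝ (Fin n)) : Prop :=
  X₀ ∈ frontier K ∧
    ¬ ∃ A B : EuclideanSpace ℝ (Fin n), A ≠ B ∧ segment ℝ A B ⊆ frontier K ∧ X₀ ∈ segment ℝ A B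

theorem abs_prod_one_add_sub_le {ι : Type*} (s : Finset ι) (a : ι → ℝ) {ε : ℝ}
    (hε1 : ε ≤ 1) (ha : ∀ i ∈ s, |a i| ≤ ε) :
    |∏ i ∈ s, (1 + a i) - 1 - ∑ i ∈ s, a i| ≤ 3 ^ s.card * ε ^ 2 := by
  classical
  induction s using Finset.induction_on with
  | empty => simpa using sq_nonneg ε
  | insert b s hb ih =>
    have hs : ∀ i ∈ s, |a i| ≤ ε := fun i hi => ha i (Finset.mem_insert_of_mem hi)
    have hab : |a b| ≤ ε := ha b (Finset.mem_insert_self b s)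
    have hε0 : 0 ≤ ε := (abs_nonneg _).trans hab
    specialize ih hs
    have hsum : |∑ i ∈ s, a i| ≤ s.card * ε := by
      refine (Finset.abs_sum_le_sum_abs _ _).trans ?_
      simpa using Finset.sum_le_sum hs
    have hcard : (s.card : ℝ) ≤ 3 ^ s.card := by
      exact_mod_cast (Nat.lt_pow_self (by norm_num : 1 < 3)).le
    rw [Finset.prod_insert hb, Finset.sum_insert hb, Finset.card_insert_of_notMem hb]
    set P := ∏ i ∈ s, (1 + a i)
    set S := ∑ i ∈ s, a i
    have h1 : (1 + a b) * P - 1 - (a b + S) = (P - 1 - S) * (1 + a b) + S * a b := by ring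
    have h2 : |1 + a b| ≤ 2 := by
      rw [abs_le] at hab ⊢
      constructor <;> linarith [hab.1, hab.2]
    rw [h1]
    calc |(P - 1 - S) * (1 + a b) + S * a b|
        ≤ |P - 1 - S| * |1 + a b| + |S| * |a b| := by
          rw [← abs_mul, ← abs_mul]; exact abs_add_le _ _
      _ ≤ (3 ^ s.card * ε ^ 2) * 2 + (s.card * ε) * ε := by gcongr
      _ ≤ (3 ^ s.card * ε ^ 2) * 2 + 3 ^ s.card * ε * ε := by gcongr
      _ = 3 ^ (s.card + 1) * ε ^ 2 := by ring

theorem abs_prod_perm_one_add_le {ι : Type*} [Fintype ι] [DecidableEq ι] (E : Matrix ι ι ℝ)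
    {ε : ℝ} (hε0 : 0 ≤ ε) (hε1 : ε ≤ 1) (hE : ∀ i j, |E i j| ≤ ε) {σ : Equiv.Perm ι}
    (hσ : σ ≠ 1) :
    |∏ i, (1 + E) (σ i) i| ≤ 2 ^ Fintype.card ι * ε ^ 2 := by
  rw [Finset.abs_prod]
  calc ∏ i, |(1 + E) (σ i) i| ≤ ∏ i, 2 * (if i ∈ σ.support then ε else 1) := by
        refine Finset.prod_le_prod (fun _ _ => abs_nonneg _) fun i _ => ?_
        split_ifs with h
        · rw [Equiv.Perm.mem_support] at h
          simp only [Matrix.add_apply, Matrix.one_apply_ne h, zero_add]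
          linarith [hE (σ i) i]
        · rw [Equiv.Perm.notMem_support] at h
          rw [h, Matrix.add_apply, Matrix.one_apply_eq]
          have := abs_le.1 (hE i i)
          rw [abs_le]
          constructor <;> linarith [this.1, this.2]
    _ = 2 ^ Fintype.card ι * ε ^ σ.support.card := by
        rw [Finset.prod_mul_distrib, Finset.prod_ite_mem]
        simp
    _ ≤ 2 ^ Fintype.card ι * ε ^ 2 := by
        gcongr 2 ^ Fintype.card ι * ?_
        exact pow_le_pow_of_le_one hε0 hε1 (Equiv.Perm.two_le_card_support_of_ne_one hσ)

theorem abs_det_one_add_sub_le {ι : Type*} [Fintype ι] [DecidableEq ι] (E : Matrix ι ι ℝ)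
    {ε : ℝ} (hε0 : 0 ≤ ε) (hε1 : ε ≤ 1) (hE : ∀ i j, |E i j| ≤ ε) :
    |(1 + E).det - 1 - E.trace| ≤
      (3 ^ Fintype.card ι + (Fintype.card ι).factorial * 2 ^ Fintype.card ι) * ε ^ 2 := by
  have hid := abs_prod_one_add_sub_le Finset.univ (fun i => E i i) hε1 fun i _ => hE i i
  rw [Matrix.det_apply', ← Finset.add_sum_erase _ _ (Finset.mem_univ (1 : Equiv.Perm ι))]
  have hrest : |∑ σ ∈ Finset.univ.erase (1 : Equiv.Perm ι),
      ((Equiv.Perm.sign σ : ℤ) : ℝ) * ∏ i, (1 + E) (σ i) i| ≤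
      (Fintype.card ι).factorial * (2 ^ Fintype.card ι * ε ^ 2) := by
    refine (Finset.abs_sum_le_sum_abs _ _).trans ?_
    calc _ ≤ ∑ σ ∈ Finset.univ.erase (1 : Equiv.Perm ι), 2 ^ Fintype.card ι * ε ^ 2 := by
          refine Finset.sum_le_sum fun σ hσ => ?_
          have h1 : |((Equiv.Perm.sign σ : ℤ) : ℝ)| = 1 := by
            rcases Int.units_eq_one_or (Equiv.Perm.sign σ) with h | h <;> simp [h]
          rw [abs_mul, h1, one_mul]
          exact abs_prod_perm_one_add_le E hε0 hε1 hE (Finset.ne_of_mem_erase hσ)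
      _ ≤ ∑ σ : Equiv.Perm ι, 2 ^ Fintype.card ι * ε ^ 2 :=
          Finset.sum_le_sum_of_subset_of_nonneg (Finset.erase_subset _ _)
            fun _ _ _ => by positivity
      _ = _ := by simp [Fintype.card_perm]
  set R := ∑ σ ∈ Finset.univ.erase (1 : Equiv.Perm ι),
      ((Equiv.Perm.sign σ : ℤ) : ℝ) * ∏ i, (1 + E) (σ i) i
  have hmain : ((Equiv.Perm.sign (1 : Equiv.Perm ι) : ℤ) : ℝ) *
      ∏ i, (1 + E) ((1 : Equiv.Perm ι) i) i + R - 1 - E.trace =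
      (∏ i, (1 + E i i) - 1 - ∑ i, E i i) + R := by
    simp [Matrix.trace]
    ring
  rw [hmain]
  refine (abs_add_le _ _).trans ?_
  rw [Finset.card_univ] at hid
  linarith

theorem abs_det_smul_one_add_sub_le {n : ℕ} (hn : n ≠ 0) {t : ℝ} (ht : 0 < t)
    (E : Matrix (Fin n) (Fin n) ℝ) {ε : ℝ} (hε0 : 0 ≤ ε) (hε1 : ε ≤ t)
    (hE : ∀ i j, |E i j| ≤ ε) :
    |(t • (1 : Matrix (Fin n) (Fin n) ℝ) + E).det - t ^ n - t ^ (n - 1) * E.trace| ≤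
      t ^ n * (3 ^ n + n.factorial * 2 ^ n) * (ε / t) ^ 2 := by
  have h := abs_det_one_add_sub_le (t⁻¹ • E) (ε := ε / t) (by positivity)
    ((div_le_one ht).2 hε1) (fun i j => by
      rw [Matrix.smul_apply, smul_eq_mul, abs_mul, abs_of_pos (inv_pos.2 ht), div_eq_inv_mul]
      gcongr
      exact hE i j)
  rw [Fintype.card_fin, Matrix.trace_smul, smul_eq_mul] at h
  have hfac : t • (1 : Matrix (Fin n) (Fin n) ℝ) + E = t • (1 + t⁻¹ • E) := by
    rw [smul_add, smul_smul, mul_inv_cancel₀ ht.ne', one_smul]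
  obtain ⟨k, rfl⟩ := Nat.exists_eq_succ_of_ne_zero hn
  have hpow : t ^ (k.succ - 1) = t ^ k.succ * t⁻¹ := by
    rw [Nat.succ_sub_one, pow_succ, mul_assoc, mul_inv_cancel₀ ht.ne', mul_one]
  rw [hfac, Matrix.det_smul, Fintype.card_fin, hpow, mul_assoc (t ^ k.succ) t⁻¹]
  rw [show t ^ k.succ * (1 + t⁻¹ • E).det - t ^ k.succ - t ^ k.succ * (t⁻¹ * E.trace) =
    t ^ k.succ * ((1 + t⁻¹ • E).det - 1 - t⁻¹ * E.trace) by ring, abs_mul,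
    abs_of_pos (by positivity), mul_assoc]
  gcongr

theorem detInt_zero_eq_det {n : ℕ} (A : Set (EuclideanSpace ℝ (Fin n)))
    (hA : ∀ i j : Fin n, IntegrableOn (fun x : EuclideanSpace ℝ (Fin n) => x i * x j) A) :
    detInt A 0 = (Matrix.of fun i j : Fin n => ∫ x in A, x i * x j).det := by
  set S : Matrix (Fin n) (Fin n) ℝ := Matrix.of fun i j : Fin n => ∫ x in A, x i * x j
  have hexp : ∀ X : Fin n → EuclideanSpace ℝ (Fin n),
      (Matrix.det (Matrix.of fun i j : Fin n =>
        X j i - (0 : EuclideanSpace ℝ (Fin n)) i)) ^ 2 =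
      ∑ σ : Equiv.Perm (Fin n), ∑ τ : Equiv.Perm (Fin n),
        (((Equiv.Perm.sign σ : ℤ) : ℝ) * ((Equiv.Perm.sign τ : ℤ) : ℝ)) *
          ∏ j, (X j (σ j) * X j (τ j)) := by
    intro X
    rw [sq, Matrix.det_apply', Finset.sum_mul_sum]
    refine Finset.sum_congr rfl fun σ _ => Finset.sum_congr rfl fun τ _ => ?_
    simp only [Matrix.of_apply, PiLp.zero_apply, sub_zero, Finset.prod_mul_distrib]
    ring
  have hint : ∀ σ τ : Equiv.Perm (Fin n), Integrable
      (fun X : Fin n → EuclideanSpace ℝ (Fin n) => ∏ j, (X j (σ j) * X j (τ j)))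
      (Measure.pi fun _ : Fin n => (volume : Measure (EuclideanSpace ℝ (Fin n))).restrict A) :=
    fun σ τ => Integrable.fintype_prod
      (f := fun j (x : EuclideanSpace ℝ (Fin n)) => x (σ j) * x (τ j))
      fun j => hA (σ j) (τ j)
  have hval : ∀ σ τ : Equiv.Perm (Fin n),
      ∫ X, ∏ j, (X j (σ j) * X j (τ j))
      ∂(Measure.pi fun _ : Fin n => (volume : Measure (EuclideanSpace ℝ (Fin n))).restrict A)
      = ∏ j, S (σ j) (τ j) :=
    fun σ τ => integral_fintype_prod_eq_prod
      (fun j (x : EuclideanSpace ℝ (Fin n)) => x (σ j) * x (τ j))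
  have hinner : ∀ σ : Equiv.Perm (Fin n), ∑ τ : Equiv.Perm (Fin n),
      (((Equiv.Perm.sign σ : ℤ) : ℝ) * ((Equiv.Perm.sign τ : ℤ) : ℝ)) *
        ∏ j, S (σ j) (τ j) = S.det := by
    intro σ
    have h1 := Matrix.det_permute σ S
    rw [← Matrix.det_transpose, Matrix.det_apply'] at h1
    simp only [Matrix.transpose_apply, Matrix.submatrix_apply, id] at h1
    simp only [mul_assoc]
    rw [← Finset.mul_sum, h1, ← mul_assoc]
    rcases Int.units_eq_one_or (Equiv.Perm.sign σ) with h | h <;> simp [h]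
  have htotal : ∫ X in Set.univ.pi (fun _ : Fin n => A),
      (Matrix.det (Matrix.of fun i j : Fin n =>
        X j i - (0 : EuclideanSpace ℝ (Fin n)) i)) ^ 2
      ∂(Measure.pi fun _ : Fin n => volume) = n.factorial * S.det := by
    simp only [hexp]
    rw [Measure.restrict_pi_pi, integral_finsetSum _ fun σ _ =>
      integrable_finsetSum _ fun τ _ => (hint σ τ).const_mul _]
    have : ∀ σ : Equiv.Perm (Fin n), ∫ X, (∑ τ : Equiv.Perm (Fin n),
        (((Equiv.Perm.sign σ : ℤ) : ℝ) * ((Equiv.Perm.sign τ : ℤ) : ℝ)) *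
          ∏ j, (X j (σ j) * X j (τ j)))
        ∂(Measure.pi fun _ : Fin n =>
          (volume : Measure (EuclideanSpace ℝ (Fin n))).restrict A) = S.det := by
      intro σ
      rw [integral_finsetSum _ fun τ _ => (hint σ τ).const_mul _, ← hinner σ]
      refine Finset.sum_congr rfl fun τ _ => ?_
      rw [integral_const_mul, hval]
    simp [this, Fintype.card_perm]
  rw [detInt, htotal, inv_mul_cancel_left₀ (by positivity)]

theorem integral_coord_mul_coord_of_isIsotropic {n : ℕ} {K : Set (EuclideanSpace ℝ (Fin n))}
    {M : ℝ} (hiso : IsIsotropic K M)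
    (hK : ∀ i j : Fin n, IntegrableOn (fun x : EuclideanSpace ℝ (Fin n) => x i * x j) K)
    (i j : Fin n) :
    ∫ x in K, x i * x j = (M ^ 2 • (1 : Matrix (Fin n) (Fin n) ℝ)) i j := by
  have hcoord : ∀ k : Fin n, ∫ x in K, x k * x k = M ^ 2 := by
    intro k
    simpa [sq, EuclideanSpace.inner_single_right] using hiso.2.2 (EuclideanSpace.single k 1)
  rcases eq_or_ne i j with rfl | hij
  · simp [hcoord]
  · have h := hiso.2.2 (EuclideanSpace.single i 1 + EuclideanSpace.single j 1)
    have hnorm : ‖(EuclideanSpace.single i 1 + EuclideanSpace.single j 1 :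
        EuclideanSpace ℝ (Fin n))‖ ^ 2 = 2 := by
      rw [norm_add_sq_real]
      simp [EuclideanSpace.inner_single_right, hij.symm]
      norm_num
    have hexp : ∀ x : EuclideanSpace ℝ (Fin n),
        (⟪x, EuclideanSpace.single i 1 + EuclideanSpace.single j 1⟫_ℝ) ^ 2 =
          x i * x i + 2 * (x i * x j) + x j * x j := by
      intro x
      simp only [inner_add_right, EuclideanSpace.inner_single_right]
      simp
      ring
    simp only [hexp, hnorm] at h
    have hij2 : IntegrableOn (fun x : EuclideanSpace ℝ (Fin n) => 2 * (x i * x j)) K :=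
      (hK i j).const_mul 2
    have hsum : IntegrableOn
        (fun x : EuclideanSpace ℝ (Fin n) => x i * x i + 2 * (x i * x j)) K :=
      (hK i i).add hij2
    rw [integral_add hsum (hK j j), integral_add (hK i i) hij2, integral_const_mul,
      hcoord, hcoord] at h
    simp only [Matrix.smul_apply, Matrix.one_apply_ne hij, smul_zero]
    linarith

/-- A point of a convex set `K ∪ C` far away from `K` forces `C` to have substantial volume. -/
theorem exists_ball_subset_of_far {E : Type*} [NormedAddCommGroup E] [NormedSpace ℝ E]
    {K C : Set E} (hconv : Convex ℝ (K ∪ C)) {x₀ x : E} {r ρ : ℝ}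
    (hr : ball x₀ r ⊆ K) (hρ : K ⊆ closedBall x₀ ρ) (hx : x ∈ C)
    (hfar : 2 * ρ + r < dist x x₀) :
    ball (midpoint ℝ x x₀) (r / 2) ⊆ C := by
  intro y hy
  have hz : (2 : ℝ) • y - x ∈ ball x₀ r := by
    rw [mem_ball, dist_eq_norm] at hy ⊢
    have h1 : (2 : ℝ) • y - x - x₀ = (2 : ℝ) • (y - midpoint ℝ x x₀) := by
      rw [midpoint_eq_smul_add, smul_sub, smul_smul]
      simp only [invOf_eq_inv, mul_inv_cancel₀ (two_ne_zero' ℝ), one_smul]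
      abel
    rw [h1, norm_smul, Real.norm_two]
    linarith
  have hmem : y ∈ K ∪ C := by
    have := hconv (Or.inr hx) (Or.inl (hr hz)) (a := 1 / 2) (b := 1 / 2)
      (by norm_num) (by norm_num) (by norm_num)
    convert this using 1
    rw [smul_sub, smul_smul]
    norm_num
  refine hmem.resolve_left fun hyK => ?_
  have h1 : dist y x₀ ≤ ρ := hρ hyK
  have h2 : dist x x₀ ≤ dist x ((2 : ℝ) • y - x₀) + dist ((2 : ℝ) • y - x₀) x₀ :=
    dist_triangle _ _ _
  have h3 : dist x ((2 : ℝ) • y - x₀) < r := by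
    rw [mem_ball, dist_eq_norm] at hz
    rw [dist_comm, dist_eq_norm]
    convert hz using 2
    abel
  have h4 : dist ((2 : ℝ) • y - x₀) x₀ = 2 * dist y x₀ := by
    rw [dist_eq_norm, dist_eq_norm, ← Real.norm_two, ← norm_smul, Real.norm_two]
    congr 1
    rw [smul_sub, two_smul ℝ x₀]
    abel
  linarith

theorem exists_eventually_norm_le {n : ℕ} {K : Set (EuclideanSpace ℝ (Fin n))}
    (hK : IsConvexBody K) {C : ℕ → Set (EuclideanSpace ℝ (Fin n))}
    (hto0 : Tendsto (fun m => volume (C m)) atTop (𝓝 0))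
    (hconv : ∀ m, Convex ℝ (K ∪ C m)) :
    ∃ R, ∀ᶠ m in atTop, ∀ x ∈ C m, ‖x‖ ≤ R := by
  obtain ⟨x₀, hx₀⟩ := hK.2.2
  obtain ⟨r, hr0, hr⟩ := Metric.mem_nhds_iff.1 (mem_interior_iff_mem_nhds.1 hx₀)
  obtain ⟨ρ, hρ⟩ := hK.1.isBounded.subset_closedBall x₀
  refine ⟨2 * ρ + r + ‖x₀‖, ?_⟩
  have hball : 0 < volume (ball (0 : EuclideanSpace ℝ (Fin n)) (r / 2)) :=
    measure_ball_pos _ _ (by positivity)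
  filter_upwards [hto0.eventually_lt_const hball] with m hm x hx
  by_contra! hlt
  have hfar : 2 * ρ + r < dist x x₀ := by
    have : ‖x‖ ≤ dist x x₀ + ‖x₀‖ := by
      rw [dist_eq_norm]; exact norm_le_norm_sub_add x x₀
    linarith
  refine (measure_mono (μ := volume)
    (exists_ball_subset_of_far (hconv m) hr hρ hx hfar)).not_gt ?_
  rwa [Measure.addHaar_ball_center]

theorem EuclideanSpace.abs_coord_mul_coord_le {n : ℕ} (x : EuclideanSpace ℝ (Fin n))
    (i j : Fin n) : |x i * x j| ≤ ‖x‖ ^ 2 := by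
  rw [abs_mul, sq]
  gcongr
  · exact PiLp.norm_apply_le x i
  · exact PiLp.norm_apply_le x j

/-- **Lemma 1 (Meyer–Reisner).** Effect of adding small outer sets `C m` to an isotropic
convex body on the iterated determinant integral. -/
theorem detInt_union_outer_sets {n : ℕ} (K : Set (EuclideanSpace ℝ (Fin n))) (M : ℝ)
    (hK : IsConvexBody K) (hiso : IsIsotropic K M)
    (C : ℕ → Set (EuclideanSpace ℝ (Fin n)))
    (hmeas : ∀ m, MeasurableSet (C m))
    (hdisj : ∀ m, C m ∩ interior K = ∅)
    (hpos : ∀ m, 0 < volume (C m))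
    (hto0 : Tendsto (fun m => volume (C m)) atTop (𝓝 0))
    (hconv : ∀ m, IsConvexBody (K ∪ C m)) :
    ∃ c > (0 : ℝ), ∃ m₀ : ℕ, ∀ m ≥ m₀,
      |detInt (K ∪ C m) 0 - M ^ (2 * n)
          - M ^ (2 * (n - 1)) * ∫ x in C m, ‖x‖ ^ 2|
        ≤ c * ((volume ((K ∪ C m) \ K)).toReal) ^ 2 := by
  have hn : n ≠ 0 := by
    rintro rfl
    obtain ⟨x₀, hx₀⟩ := hK.2.2
    obtain ⟨x, hx⟩ := nonempty_of_measure_ne_zero (μ := volume) (hpos 0).ne'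
    have : x ∈ C 0 ∩ interior K := ⟨hx, Subsingleton.elim x₀ x ▸ hx₀⟩
    simp [hdisj 0] at this
  have hnull : ∀ m, volume (C m ∩ K) = 0 := by
    intro m
    refine measure_mono_null (fun x hx => ?_) (hK.2.1.addHaar_frontier volume)
    refine ⟨subset_closure hx.2, fun hxi => ?_⟩
    have : x ∈ C m ∩ interior K := ⟨hx.1, hxi⟩
    simp [hdisj m] at this
  have hintC : ∀ m (i j : Fin n), IntegrableOn
      (fun x : EuclideanSpace ℝ (Fin n) => x i * x j) (K ∪ C m) := fun m i j =>
    ContinuousOn.integrableOn_compact (hconv m).1 (by fun_prop)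
  have hintK : ∀ i j : Fin n, IntegrableOn
      (fun x : EuclideanSpace ℝ (Fin n) => x i * x j) K := fun i j =>
    (hintC 0 i j).mono_set subset_union_left
  obtain ⟨R, hR⟩ := exists_eventually_norm_le hK hto0 fun m => (hconv m).2.1
  have hM2 : 0 < M ^ 2 := pow_pos hiso.1 2
  have hsmall : ∀ᶠ m in atTop, R ^ 2 * (volume (C m)).toReal ≤ M ^ 2 := by
    have h0 : Tendsto (fun m => R ^ 2 * (volume (C m)).toReal) atTop (𝓝 0) := by
      simpa using ((ENNReal.tendsto_toReal ENNReal.zero_ne_top).comp hto0).const_mul (R ^ 2)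
    exact (h0.eventually_lt_const hM2).mono fun _ h => h.le
  obtain ⟨m₀, hm₀⟩ := eventually_atTop.1 (hR.and hsmall)
  refine ⟨(M ^ 2) ^ n * (3 ^ n + n.factorial * 2 ^ n) * (R ^ 2 / M ^ 2) ^ 2 + 1,
    by positivity, m₀, fun m hm => ?_⟩
  obtain ⟨hRm, hsm⟩ := hm₀ m hm
  have hvol : volume ((K ∪ C m) \ K) = volume (C m) := by
    rw [union_sdiff_left]
    exact measure_sdiff_null' (hnull m)
  have hfin : volume (C m) < ⊤ :=
    (measure_mono subset_union_right).trans_lt (hconv m).1.measure_lt_top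
  set E : Matrix (Fin n) (Fin n) ℝ := Matrix.of fun i j => ∫ x in C m, x i * x j
  have hEle : ∀ i j, |E i j| ≤ R ^ 2 * (volume (C m)).toReal := by
    intro i j
    refine norm_setIntegral_le_of_norm_le_const
      (f := fun x : EuclideanSpace ℝ (Fin n) => x i * x j) hfin fun x hx => ?_
    exact (EuclideanSpace.abs_coord_mul_coord_le x i j).trans
      (pow_le_pow_left₀ (norm_nonneg x) (hRm x hx) 2)
  have htrace : E.trace = ∫ x in C m, ‖x‖ ^ 2 := by
    simp only [EuclideanSpace.real_norm_sq_eq]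
    simp only [sq]
    rw [integral_finsetSum _ fun i _ => (hintC m i i).mono_set subset_union_right]
    rfl
  have hsplit : (Matrix.of fun i j : Fin n => ∫ x in K ∪ C m, x i * x j) =
      M ^ 2 • (1 : Matrix (Fin n) (Fin n) ℝ) + E := by
    ext i j
    rw [Matrix.of_apply, setIntegral_union₀
      (by rw [AEDisjoint, inter_comm]; exact hnull m)
      (hmeas m).nullMeasurableSet (hintK i j) ((hintC m i j).mono_set subset_union_right),
      integral_coord_mul_coord_of_isIsotropic hiso hintK]
    rfl
  have hdet := abs_det_smul_one_add_sub_le hn hM2 E (by positivity) hsm hEle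
  rw [← hsplit, ← detInt_zero_eq_det _ (hintC m), htrace] at hdet
  rw [hvol, pow_mul, pow_mul]
  refine hdet.trans ?_
  rw [show (R ^ 2 * (volume (C m)).toReal / M ^ 2) ^ 2 =
    (R ^ 2 / M ^ 2) ^ 2 * (volume (C m)).toReal ^ 2 by ring, ← mul_assoc]
  gcongr
  linarith
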